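/- arXiv:math/0509082 — 4 statements merged into one kernel-verified Lean document; each statement's English description precedes it below -/
import Mathlib

section
/- Let (b_1, …, b_k) be a simple continued fraction expansion (SCFE) and (a_1, …, a_l) a minimal continued fraction expansion (MCFE) with cf(b_1, …, b_k) = cf(a_1, …, a_l). Let N, N' ∈ ℤ be such that the evaluations of the extended lists (b_1, …, b_k, N) and (a_1, …, a_l, N') are well-defined and cf(b_1, …, b_k, N) = cf(a_1, …, a_l, N'). Then either N' = N or N' = N − sgn(b_k). -/
/-- Continued fraction value of a list of integers: `cf [] = 0`,
`cf (b :: t) = 1 / (b - cf t)`, computed in `ℚ` (with the convention `1/0 = 0`). -/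
def cf : List ℤ → ℚ
  | [] => 0
  | b :: t => 1 / ((b : ℚ) - cf t)

/-- The evaluation of a continued fraction is well-defined if no division by zero occurs. -/
def cfWD : List ℤ → Prop
  | [] => True
  | b :: t => ((b : ℚ) ≠ cf t) ∧ cfWD t

/-- A nonempty list of integers `(b_1, …, b_k)` is a simple continued fraction expansion:
consecutive coefficients have non-positive product (alternating signs), every coefficient
except possibly the first is nonzero, and the last coefficient has absolute value at least 2. -/
def SCFE (l : List ℤ) : Prop :=
  l ≠ [] ∧
  (∀ i, i + 1 < l.length → l.getD i 0 * l.getD (i + 1) 0 ≤ 0) ∧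
  (∀ i, 0 < i → i < l.length → l.getD i 0 ≠ 0) ∧
  2 ≤ |l.getLastD 0|

/-- Minimal continued fraction expansion: every coefficient has absolute value at least 2. -/
def MCFE (l : List ℤ) : Prop := ∀ x ∈ l, 2 ≤ |x|

/-- The matrix of the Möbius transformation `x ↦ 1 / (b - x)`. -/
def cfStep (b : ℤ) : Matrix (Fin 2) (Fin 2) ℤ := !![0, 1; -1, b]

/-- The matrix of the Möbius transformation `x ↦ 1 / (b₁ - 1 / (b₂ - ⋯ 1 / (bₖ - x)))`. -/
def cfMatrix (l : List ℤ) : Matrix (Fin 2) (Fin 2) ℤ := (l.map cfStep).prod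

lemma cfMatrix_nil : cfMatrix [] = 1 := rfl

lemma cfMatrix_cons (b : ℤ) (l : List ℤ) : cfMatrix (b :: l) = cfStep b * cfMatrix l := by
  simp [cfMatrix]

lemma cfMatrix_concat (l : List ℤ) (b : ℤ) : cfMatrix (l ++ [b]) = cfMatrix l * cfStep b := by
  simp [cfMatrix]

lemma cfMatrix_det (l : List ℤ) :
    cfMatrix l 0 0 * cfMatrix l 1 1 - cfMatrix l 0 1 * cfMatrix l 1 0 = 1 := by
  rw [← Matrix.det_fin_two]
  induction l with
  | nil => simp [cfMatrix_nil]
  | cons b t ih => rw [cfMatrix_cons, Matrix.det_mul, ih]; simp [cfStep, Matrix.det_fin_two]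

lemma cfMatrix_concat_apply_one (l : List ℤ) (b : ℤ) (i : Fin 2) :
    cfMatrix (l ++ [b]) i 1 = cfMatrix l i 0 + cfMatrix l i 1 * b := by
  simp [cfMatrix_concat, cfStep, Matrix.mul_apply, Fin.sum_univ_two]

lemma cfMatrix_concat_apply_zero (l : List ℤ) (b : ℤ) (i : Fin 2) :
    cfMatrix (l ++ [b]) i 0 = -cfMatrix l i 1 := by
  simp [cfMatrix_concat, cfStep, Matrix.mul_apply, Fin.sum_univ_two]

/-- A well-defined continued fraction is the quotient of the entries of the second column
of its matrix. -/
lemma cf_eq_div (l : List ℤ) (h : cfWD l) :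
    (cfMatrix l 1 1 : ℚ) ≠ 0 ∧ cf l = cfMatrix l 0 1 / cfMatrix l 1 1 := by
  induction l with
  | nil => simp [cfMatrix_nil, cf]
  | cons b t ih =>
    obtain ⟨hq, ht⟩ := ih h.2
    have hb : (b : ℚ) - cf t ≠ 0 := sub_ne_zero.2 h.1
    have h0 : cfMatrix (b :: t) 0 1 = cfMatrix t 1 1 := by
      simp [cfMatrix_cons, cfStep, Matrix.mul_apply, Fin.sum_univ_two]
    have h1 : (cfMatrix (b :: t) 1 1 : ℚ) = (b - cf t) * cfMatrix t 1 1 := by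
      have : (cfMatrix (b :: t) 1 1 : ℤ) = -cfMatrix t 0 1 + b * cfMatrix t 1 1 := by
        simp [cfMatrix_cons, cfStep, Matrix.mul_apply, Fin.sum_univ_two]
      rw [this, ht]
      push_cast
      field_simp
      ring
    rw [h0, h1, cf]
    exact ⟨mul_ne_zero hb hq, by field_simp⟩

/-- Appending a coefficient `N` to a continued fraction with denominator `q` changes its value by
the inverse of `q` times the new denominator. -/
lemma cf_concat_sub (l : List ℤ) (N : ℤ) (h : cfWD l) (hN : cfWD (l ++ [N])) :
    cf (l ++ [N]) - cf l
      = ((cfMatrix l 1 1 * (cfMatrix l 1 0 + cfMatrix l 1 1 * N) : ℤ) : ℚ)⁻¹ := by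
  obtain ⟨hq, hl⟩ := cf_eq_div l h
  obtain ⟨hq', hl'⟩ := cf_eq_div _ hN
  have hdet : (cfMatrix l 0 0 * cfMatrix l 1 1 - cfMatrix l 0 1 * cfMatrix l 1 0 : ℚ) = 1 := by
    exact_mod_cast cfMatrix_det l
  rw [cfMatrix_concat_apply_one] at hq'
  rw [hl', hl, cfMatrix_concat_apply_one, cfMatrix_concat_apply_one]
  push_cast at hq' ⊢
  rw [div_sub_div _ _ hq' hq, inv_eq_one_div, div_eq_div_iff (mul_ne_zero hq' hq)
    (mul_ne_zero hq hq')]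
  linear_combination (cfMatrix l 1 1 * (cfMatrix l 1 0 + cfMatrix l 1 1 * N) : ℚ) * hdet

lemma cfMatrix_denom_dvd (a b : List ℤ) (ha : cfWD a) (hb : cfWD b) (h : cf b = cf a) :
    cfMatrix a 1 1 ∣ cfMatrix b 1 1 := by
  obtain ⟨hqa, hpa⟩ := cf_eq_div a ha
  obtain ⟨hqb, hpb⟩ := cf_eq_div b hb
  have hcop : IsCoprime (cfMatrix a 1 1) (cfMatrix a 0 1) :=
    ⟨cfMatrix a 0 0, -cfMatrix a 1 0, by linear_combination cfMatrix_det a⟩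
  rw [hpa, hpb, div_eq_div_iff hqb hqa] at h
  exact hcop.dvd_of_dvd_mul_left ⟨cfMatrix b 0 1, by
    have : cfMatrix b 0 1 * cfMatrix a 1 1 = cfMatrix a 0 1 * cfMatrix b 1 1 := by exact_mod_cast h
    linear_combination -this⟩

lemma MCFE.wd_and_abs_cf_lt_one {l : List ℤ} (h : MCFE l) : cfWD l ∧ |cf l| < 1 := by
  induction l with
  | nil => simp [cfWD, cf]
  | cons b t ih =>
    obtain ⟨hwd, hlt⟩ := ih fun x hx => h x (List.mem_cons_of_mem _ hx)
    have hb : (2 : ℚ) ≤ |(b : ℚ)| := by exact_mod_cast h b List.mem_cons_self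
    have hgt : 1 < |(b : ℚ) - cf t| := by linarith [abs_sub_abs_le_abs_sub (b : ℚ) (cf t)]
    refine ⟨⟨fun he => ?_, hwd⟩, ?_⟩
    · rw [he, sub_self, abs_zero] at hgt
      linarith
    · rw [cf, abs_div, abs_one, div_lt_one (by linarith)]
      exact hgt

lemma MCFE.abs_denom_lt {l : List ℤ} (h : MCFE l) : |cfMatrix l 1 0| < |cfMatrix l 1 1| := by
  induction l using List.reverseRecOn with
  | nil => simp [cfMatrix_nil]
  | append_singleton l a ih =>
    specialize ih fun x hx => h x (by simp [hx])
    have ha : 2 ≤ |a| := h a (by simp)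
    rw [cfMatrix_concat_apply_zero, cfMatrix_concat_apply_one, abs_neg]
    have h1 := abs_sub_abs_le_abs_sub (cfMatrix l 1 1 * a) (-cfMatrix l 1 0)
    rw [sub_neg_eq_add, abs_neg, abs_mul, add_comm] at h1
    nlinarith [abs_nonneg (cfMatrix l 1 1)]

/-- The sign of an alternating continued fraction is opposite to that of a coefficient which
may be put in front of it. -/
lemma cf_alternating {t : List ℤ} (c : ℤ) (h : (c :: t).IsChain (fun x y => x * y < 0)) :
    cfWD t ∧ (c : ℚ) * cf t ≤ 0 := by
  induction t generalizing c with
  | nil => simp [cfWD, cf]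
  | cons d t ih =>
    rw [List.isChain_cons_cons] at h
    obtain ⟨hwd, hle⟩ := ih d h.2
    have hcd : (c : ℚ) * d < 0 := by exact_mod_cast h.1
    have hd : (d : ℚ) ≠ 0 := by intro h0; simp [h0] at hcd
    have hpos : 0 < (d : ℚ) * (d - cf t) := by nlinarith [sq_pos_of_ne_zero hd]
    have hne : (d : ℚ) - cf t ≠ 0 := right_ne_zero_of_mul hpos.ne'
    refine ⟨⟨sub_ne_zero.1 hne, hwd⟩, ?_⟩
    have : (c : ℚ) * cf (d :: t) = (c * d) / (d * (d - cf t)) := by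
      rw [cf]; field_simp
    rw [this]
    exact div_nonpos_of_nonpos_of_nonneg hcd.le hpos.le

lemma cf_alternating_cons {t : List ℤ} (c : ℤ) (h : (c :: t).IsChain (fun x y => x * y < 0))
    (hc : c ≠ 0) : cfWD (c :: t) ∧ cf (c :: t) ≠ 0 ∧ |cf (c :: t)| ≤ 1 := by
  obtain ⟨hwd, hle⟩ := cf_alternating c h
  have hc1 : (1 : ℚ) ≤ (c : ℚ) ^ 2 := by
    exact_mod_cast Int.add_one_le_of_lt (sq_pos_of_ne_zero hc)
  have h1 : 1 ≤ |(c : ℚ) - cf t| := by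
    rw [← one_le_sq_iff_one_le_abs]
    nlinarith [sq_nonneg (cf t)]
  have hne : (c : ℚ) - cf t ≠ 0 := abs_pos.1 (by linarith)
  refine ⟨⟨sub_ne_zero.1 hne, hwd⟩, one_div_ne_zero hne, ?_⟩
  rw [cf, abs_div, abs_one, div_le_one (by linarith)]
  exact h1

lemma cfMatrix_alternating {l : List ℤ} (a : ℤ)
    (h : (l ++ [a]).IsChain (fun x y => x * y < 0)) :
    0 ≤ a * (cfMatrix l 1 0 * cfMatrix l 1 1) ∧ cfMatrix l 1 1 ≠ 0 := by
  induction l using List.reverseRecOn generalizing a with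
  | nil => simp [cfMatrix_nil]
  | append_singleton l c ih =>
    have hca : c * a < 0 := by
      rw [List.append_assoc] at h
      simpa using h.right_of_append
    obtain ⟨h1, h2⟩ := ih c h.left_of_append
    rw [cfMatrix_concat_apply_zero, cfMatrix_concat_apply_one]
    set r := cfMatrix l 1 0
    set q := cfMatrix l 1 1
    have hc : c ≠ 0 := by rintro rfl; simp at hca
    have hpos : 0 < c * (q * (r + q * c)) := by
      nlinarith [sq_pos_of_ne_zero (mul_ne_zero hc h2)]
    refine ⟨?_, right_ne_zero_of_mul (right_ne_zero_of_mul hpos.ne')⟩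
    have : 0 < c ^ 2 * (a * (-q * (r + q * c))) := by
      nlinarith [mul_pos_of_neg_of_neg hca (neg_neg_of_pos hpos)]
    exact (pos_of_mul_pos_right this (sq_nonneg c)).le

lemma cfMatrix_alternating_last {l : List ℤ} {c : ℤ}
    (h : (l ++ [c]).IsChain (fun x y => x * y < 0)) (hc : 2 ≤ |c|) :
    c * (cfMatrix (l ++ [c]) 1 0 * cfMatrix (l ++ [c]) 1 1) ≤ 0 ∧
      |cfMatrix (l ++ [c]) 1 0| < |cfMatrix (l ++ [c]) 1 1| := by
  obtain ⟨h1, h2⟩ := cfMatrix_alternating c h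
  rw [cfMatrix_concat_apply_zero, cfMatrix_concat_apply_one]
  set r := cfMatrix l 1 0
  set q := cfMatrix l 1 1
  have hq : 0 < q ^ 2 := sq_pos_of_ne_zero h2
  have hc2 : 4 ≤ c ^ 2 := by nlinarith [sq_abs c]
  refine ⟨by nlinarith [sq_nonneg (c * q)], ?_⟩
  rw [abs_neg, ← sq_lt_sq]
  nlinarith [sq_nonneg r, mul_le_mul_of_nonneg_right hc2 hq.le]

lemma SCFE.isChain {c : ℤ} {t : List ℤ} (h : SCFE (c :: t)) (hc : c ≠ 0) :
    (c :: t).IsChain (fun x y => x * y < 0) := by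
  obtain ⟨-, h1, h2, -⟩ := h
  rw [List.isChain_iff_getElem]
  intro i hi
  have hne : ∀ j, (hj : j < (c :: t).length) → (c :: t)[j] ≠ 0 := by
    rintro (_ | j) hj
    · exact hc
    · rw [← List.getD_eq_getElem _ 0 hj]
      exact h2 (j + 1) j.succ_pos hj
  have := h1 i hi
  rw [List.getD_eq_getElem _ _ (by omega), List.getD_eq_getElem _ _ hi] at this
  exact lt_of_le_of_ne this (mul_ne_zero (hne _ _) (hne _ _))

lemma SCFE.tail {c d : ℤ} {t : List ℤ} (h : SCFE (c :: d :: t)) : SCFE (d :: t) ∧ d ≠ 0 := by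
  obtain ⟨-, h1, h2, h3⟩ := h
  refine ⟨⟨by simp, fun i hi => ?_, fun i hi hl => ?_, by simpa using h3⟩, ?_⟩
  · simpa using h1 (i + 1) (by simpa using hi)
  · simpa using h2 (i + 1) i.succ_pos (by simpa using hl)
  · simpa using h2 1 one_pos (by simp)

lemma SCFE.isChain_of_abs_cf_lt_one {b : List ℤ} (hb : SCFE b) (h : |cf b| < 1) :
    cfWD b ∧ b.IsChain (fun x y => x * y < 0) := by
  match b, hb, h with
  | [], hb, _ => exact absurd rfl hb.1
  | c :: t, hb, h =>
    by_cases hc : c = 0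
    · exfalso
      subst hc
      match t, hb, h with
      | [], hb, _ => simpa using hb.2.2.2
      | d :: t, hb, h =>
        obtain ⟨ht, hd⟩ := hb.tail
        obtain ⟨-, hne, hle⟩ := cf_alternating_cons d (ht.isChain hd) hd
        rw [cf, abs_div, abs_one, Int.cast_zero, zero_sub, abs_neg,
          div_lt_one (abs_pos.2 hne)] at h
        linarith
    · exact ⟨(cf_alternating_cons c (hb.isChain hc) hc).1, hb.isChain hc⟩

/-- If a SCFE `b` and a MCFE `a` have the same value, and appending `N` to `b`
and `N'` to `a` gives well-defined evaluations with equal values, then `N' = N` or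
`N' = N - sgn(b_k)` where `b_k` is the last coefficient of `b`. -/
theorem appended_coefficients (b a : List ℤ) (hb : SCFE b) (ha : MCFE a)
    (hval : cf b = cf a) (N N' : ℤ)
    (hwb : cfWD (b ++ [N])) (hwa : cfWD (a ++ [N']))
    (hval' : cf (b ++ [N]) = cf (a ++ [N'])) :
    N' = N ∨ N' = N - Int.sign (b.getLastD 0) := by
  obtain ⟨hwda, hlt⟩ := ha.wd_and_abs_cf_lt_one
  obtain ⟨hwdb, hchain⟩ := hb.isChain_of_abs_cf_lt_one (hval ▸ hlt)
  have hra := ha.abs_denom_lt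
  have hdenom : |cfMatrix b 1 1| = |cfMatrix a 1 1| :=
    abs_eq_abs.2 <| Int.associated_iff.1 <| associated_of_dvd_dvd
      (cfMatrix_denom_dvd b a hwdb hwda hval.symm) (cfMatrix_denom_dvd a b hwda hwdb hval)
  have hsub := cf_concat_sub b N hwdb hwb
  rw [hval, hval', cf_concat_sub a N' hwda hwa, inv_inj, Int.cast_inj] at hsub
  obtain ⟨l, c, rfl⟩ := List.eq_nil_or_concat' b |>.resolve_left hb.1
  have hc : 2 ≤ |c| := by simpa using hb.2.2.2
  obtain ⟨hsign, hrb⟩ := cfMatrix_alternating_last hchain hc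
  simp only [List.getLastD_concat]
  set q := cfMatrix (l ++ [c]) 1 1
  set r := cfMatrix (l ++ [c]) 1 0
  set q' := cfMatrix a 1 1
  set r' := cfMatrix a 1 0
  have hsq : q' ^ 2 = q ^ 2 := sq_eq_sq_iff_abs_eq_abs _ _ |>.2 hdenom.symm
  have hs : |r * q| < q ^ 2 := by
    rw [abs_mul, ← sq_abs]; nlinarith [abs_nonneg r]
  have hs' : |r' * q'| < q ^ 2 := by
    rw [abs_mul, ← hsq, ← sq_abs]; nlinarith [abs_nonneg r']
  have hkey : q ^ 2 * (N - N') = r' * q' - r * q := by linear_combination -hsub + N' * hsq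
  rw [abs_lt] at hs hs'
  have hq : 0 < q ^ 2 := by linarith
  rcases lt_or_gt_of_ne (show c ≠ 0 by rintro rfl; simp at hc) with h | h
  · rw [Int.sign_eq_neg_one_of_neg h]
    have h0 : 0 ≤ r * q := nonneg_of_mul_nonpos_right hsign h
    have h1 : N - N' < 1 := lt_of_mul_lt_mul_left (by linarith) hq.le
    have h2 : -2 < N - N' := lt_of_mul_lt_mul_left (by linarith) hq.le
    omega
  · rw [Int.sign_eq_one_of_pos h]
    have h0 : r * q ≤ 0 := nonpos_of_mul_nonpos_right hsign h
    have h1 : N - N' < 2 := lt_of_mul_lt_mul_left (by linarith) hq.le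
    have h2 : -1 < N - N' := lt_of_mul_lt_mul_left (by linarith) hq.le
    omega
end

section
/- Let W ∈ SL(2, ℤ) with first column (x, y) and y ≠ 0, let k ≥ 2, and let n_2, …, n_k be integers with |n_i| ≥ 2 for all 2 ≤ i ≤ k. Then the following are equivalent: (i) there exist J ∈ ℤ and n_1 ∈ ℤ, with J ∈ {0, 2} if k is even and J ∈ {−1, 1} if k is odd, such that W = P^J · X_k^{n_k} X_{k−1}^{n_{k−1}} ⋯ X_2^{n_2} · A^{n_1}, where X_j = A if j is odd and X_j = B if j is even (so the letters alternate and the word ends in B^{n_2} A^{n_1}); (ii) x/y = cf(n_k, n_{k−1}, …, n_2), i.e. (n_k, …, n_2) is a minimal continued fraction expansion of x/y. -/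
abbrev SL2Z := Matrix.SpecialLinearGroup (Fin 2) ℤ

def A : SL2Z := ⟨!![1, -1; 0, 1], by norm_num [Matrix.det_fin_two_of]⟩
def B : SL2Z := ⟨!![1, 0; 1, 1], by norm_num [Matrix.det_fin_two_of]⟩

/-- Alternating word `X^{n_1} Y^{n_2} X^{n_3} ⋯` in `SL(2,ℤ)` (integer exponents). -/
def altProd (X Y : SL2Z) : List ℤ → SL2Z
  | [] => 1
  | n :: t => X ^ n * altProd Y X t

def P : SL2Z := ⟨!![0, -1; 1, 0], by norm_num [Matrix.det_fin_two_of]⟩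

theorem A_zpow (n : ℤ) : ((A ^ n : SL2Z) : Matrix (Fin 2) (Fin 2) ℤ) = !![1, -n; 0, 1] := by
  induction n using Int.induction_on with
  | zero => simp [Matrix.one_fin_two]
  | succ i ih =>
    rw [zpow_add_one, Matrix.SpecialLinearGroup.coe_mul, ih]
    simp [A]
  | pred i ih =>
    rw [zpow_sub_one, Matrix.SpecialLinearGroup.coe_mul, ih,
      Matrix.SpecialLinearGroup.coe_inv]
    simp [A, Matrix.adjugate_fin_two_of]

theorem B_zpow (n : ℤ) : ((B ^ n : SL2Z) : Matrix (Fin 2) (Fin 2) ℤ) = !![1, 0; n, 1] := by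
  induction n using Int.induction_on with
  | zero => simp [Matrix.one_fin_two]
  | succ i ih =>
    rw [zpow_add_one, Matrix.SpecialLinearGroup.coe_mul, ih]
    simp [B]
  | pred i ih =>
    rw [zpow_sub_one, Matrix.SpecialLinearGroup.coe_mul, ih,
      Matrix.SpecialLinearGroup.coe_inv]
    simp [B, Matrix.adjugate_fin_two_of]
    ring

theorem P_mul_A_zpow (n : ℤ) : P * A ^ n = B ^ n * P := by
  apply Subtype.ext
  simp only [Matrix.SpecialLinearGroup.coe_mul, A_zpow, B_zpow]
  simp [P]

theorem P_mul_B_zpow (n : ℤ) : P * B ^ n = A ^ n * P := by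
  apply Subtype.ext
  simp only [Matrix.SpecialLinearGroup.coe_mul, A_zpow, B_zpow]
  simp [P]

theorem P_sq : P ^ 2 = -1 := by
  apply Subtype.ext
  rw [Matrix.SpecialLinearGroup.coe_pow, Matrix.SpecialLinearGroup.coe_neg]
  simp [P, pow_two, Matrix.one_fin_two]

theorem P_inv : P⁻¹ = -P := by
  rw [inv_eq_iff_mul_eq_one, mul_neg, ← pow_two, P_sq, neg_neg]

theorem P_mul_altProd (l : List ℤ) :
    P * altProd A B l = altProd B A l * P ∧ P * altProd B A l = altProd A B l * P := by
  induction l with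
  | nil => simp [altProd]
  | cons n t ih =>
    simp only [altProd]
    constructor
    · rw [← mul_assoc, P_mul_A_zpow, mul_assoc, ih.2, mul_assoc]
    · rw [← mul_assoc, P_mul_B_zpow, mul_assoc, ih.1, mul_assoc]

/-- The product of the matrices `!![0, 1; -1, b]` over the entries `b` of the list, times `P`;
its first column is the numerator and denominator of the continued fraction. -/
def convergentMatrix : List ℤ → SL2Z
  | [] => P
  | b :: t => B ^ b * P⁻¹ * convergentMatrix t

theorem convergentMatrix_mul_P_pow (l : List ℤ) :
    convergentMatrix l * P ^ l.length = altProd B A l * P := by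
  induction l with
  | nil => simp [convergentMatrix, altProd]
  | cons b t ih =>
    have h : P⁻¹ * (altProd B A t * P) = altProd A B t := by
      rw [← (P_mul_altProd t).1, inv_mul_cancel_left]
    rw [convergentMatrix, altProd, List.length_cons, pow_succ, ← mul_assoc,
      mul_assoc (_ * _) (convergentMatrix t), ih, mul_assoc (B ^ b), h]

theorem convergentMatrix_first_column (l : List ℤ) (hl : ∀ b ∈ l, 2 ≤ |b|) :
    |(convergentMatrix l).1 0 0| < |(convergentMatrix l).1 1 0| ∧
      ((convergentMatrix l).1 0 0 : ℚ) / (convergentMatrix l).1 1 0 = cf l := by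
  induction l with
  | nil => simp [convergentMatrix, P, cf]
  | cons b t ih =>
    obtain ⟨hlt, hcf⟩ := ih fun c hc => hl c (List.mem_cons_of_mem _ hc)
    have hb := hl b List.mem_cons_self
    set x := (convergentMatrix t).1 0 0
    set y := (convergentMatrix t).1 1 0
    have h0 : (convergentMatrix (b :: t)).1 0 0 = y := by
      simp only [convergentMatrix, P_inv, Matrix.SpecialLinearGroup.coe_mul, B_zpow,
        Matrix.SpecialLinearGroup.coe_neg]
      simp [P, Matrix.mul_apply, Fin.sum_univ_two, y]
    have h1 : (convergentMatrix (b :: t)).1 1 0 = b * y - x := by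
      simp only [convergentMatrix, P_inv, Matrix.SpecialLinearGroup.coe_mul, B_zpow,
        Matrix.SpecialLinearGroup.coe_neg]
      simp [P, Matrix.mul_apply, Fin.sum_univ_two, x, y]
      ring
    rw [h0, h1]
    have hy : y ≠ 0 := abs_pos.mp ((abs_nonneg x).trans_lt hlt)
    refine ⟨?_, ?_⟩
    · have h2 := abs_sub_abs_le_abs_sub (b * y) x
      rw [abs_mul] at h2
      nlinarith [abs_nonneg y]
    · have hy' : (y : ℚ) ≠ 0 := Int.cast_ne_zero.mpr hy
      rw [cf, ← hcf, sub_div' hy', one_div_div]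
      push_cast
      rfl

theorem exists_eq_A_zpow_iff (U : SL2Z) :
    (∃ n : ℤ, U = A ^ n ∨ U = -A ^ n) ↔ U.1 1 0 = 0 := by
  constructor
  · rintro ⟨n, rfl | rfl⟩ <;> simp [A_zpow]
  · intro h
    have hdet := U.2
    rw [Matrix.det_fin_two, h, mul_zero, sub_zero] at hdet
    rcases Int.mul_eq_one_iff_eq_one_or_neg_one.mp hdet with ⟨h0, h1⟩ | ⟨h0, h1⟩
    · refine ⟨-U.1 0 1, Or.inl (Subtype.ext ?_)⟩
      rw [A_zpow, Matrix.eta_fin_two U.1, h, h0, h1]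
      simp
    · refine ⟨U.1 0 1, Or.inr (Subtype.ext ?_)⟩
      rw [Matrix.SpecialLinearGroup.coe_neg, A_zpow, Matrix.eta_fin_two U.1, h, h0, h1]
      simp

theorem exists_eq_mul_A_zpow_iff (W S : SL2Z) :
    (∃ n : ℤ, W = S * A ^ n ∨ W = -S * A ^ n) ↔ W.1 0 0 * S.1 1 0 = S.1 0 0 * W.1 1 0 := by
  have h := exists_eq_A_zpow_iff (S⁻¹ * W)
  simp only [inv_mul_eq_iff_eq_mul, mul_neg, ← neg_mul] at h
  rw [h]
  simp [Matrix.adjugate_fin_two, Matrix.mul_apply, Fin.sum_univ_two]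
  constructor <;> intro h <;> linarith

theorem P_pow_even (m : ℕ) : P ^ (2 * m) = 1 ∨ P ^ (2 * m) = -1 := by
  rw [pow_mul, P_sq]
  exact neg_one_pow_eq_or SL2Z m

theorem special_form_iff_exists_convergentMatrix (W : SL2Z) (k : ℕ) (l : List ℤ)
    (hl : l.length + 1 = k) :
    (∃ J n1 : ℤ,
      (Even k → (J = 0 ∨ J = 2)) ∧ (Odd k → (J = -1 ∨ J = 1)) ∧
      W = P ^ J * altProd (if Even k then B else A) (if Even k then A else B) l * A ^ n1) ↔
    ∃ n : ℤ, W = convergentMatrix l * A ^ n ∨ W = -convergentMatrix l * A ^ n := by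
  have hS := convergentMatrix_mul_P_pow l
  have hsq : P ^ (2 : ℤ) = -1 := by exact_mod_cast P_sq
  rcases Nat.even_or_odd k with hk | hk
  · have hodd : ¬ Odd k := Nat.not_odd_iff_even.mpr hk
    have hal : altProd B A l = convergentMatrix l ∨ altProd B A l = -convergentMatrix l := by
      obtain ⟨m, hm⟩ : Odd l.length := by grind
      rw [hm, pow_succ, ← mul_assoc, mul_right_cancel_iff] at hS
      rw [← hS]
      rcases P_pow_even m with h | h <;> simp [h]
    simp only [hk, hodd, if_true, forall_const, false_imp_iff, true_and]
    rw [exists_comm]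
    refine exists_congr fun n => ?_
    rcases hal with h | h <;> rw [h] <;> simp [or_and_right, exists_or, hsq, or_comm]
  · have heven : ¬ Even k := Nat.not_even_iff_odd.mpr hk
    have hal : P * altProd A B l = convergentMatrix l ∨
        P * altProd A B l = -convergentMatrix l := by
      obtain ⟨m, hm⟩ : Even l.length := by grind
      rw [hm, ← two_mul, ← (P_mul_altProd l).1] at hS
      rw [← hS]
      rcases P_pow_even m with h | h <;> simp [h]
    simp only [hk, heven, if_false, forall_const, false_imp_iff, true_and]
    rw [exists_comm]
    refine exists_congr fun n => ?_
    simp only [or_and_right, exists_or, exists_eq_left, zpow_neg_one, zpow_one, P_inv, neg_mul]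
    simp only [← neg_mul]
    rcases hal with h | h <;> simp [h, or_comm]

/-- for `W ∈ SL(2,ℤ)` with first column `(x,y)`, `y ≠ 0`, `k ≥ 2` and integers
`n_2, …, n_k` of absolute value at least 2, `W` can be written as a special form
`P^J X_k^{n_k} ⋯ X_2^{n_2} A^{n_1}` (letters alternating with `X_j = A` for `j` odd and
`X_j = B` for `j` even, `J ∈ {0,2}` for `k` even and `J ∈ {-1,1}` for `k` odd) if and only if
`x/y = cf(n_k, …, n_2)`. -/
theorem special_form_iff_mcfe (W : SL2Z)
    (hy : (W : Matrix (Fin 2) (Fin 2) ℤ) 1 0 ≠ 0)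
    (k : ℕ) (hk : 2 ≤ k) (n : ℕ → ℤ)
    (habs : ∀ i, 2 ≤ i → i ≤ k → 2 ≤ |n i|) :
    (∃ J n1 : ℤ,
      (Even k → (J = 0 ∨ J = 2)) ∧ (Odd k → (J = -1 ∨ J = 1)) ∧
      W = P ^ J *
          altProd (if Even k then B else A) (if Even k then A else B)
            ((List.range (k - 1)).map fun j => n (k - j)) *
          A ^ n1) ↔
    ((W : Matrix (Fin 2) (Fin 2) ℤ) 0 0 : ℚ) / ((W : Matrix (Fin 2) (Fin 2) ℤ) 1 0 : ℚ)
      = cf ((List.range (k - 1)).map fun j => n (k - j)) := by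
  have hlen : ((List.range (k - 1)).map fun j => n (k - j)).length + 1 = k := by
    simp only [List.length_map, List.length_range]
    omega
  have hmem : ∀ b ∈ (List.range (k - 1)).map fun j => n (k - j), 2 ≤ |b| := by
    intro b hb
    obtain ⟨j, hj, rfl⟩ := List.mem_map.mp hb
    rw [List.mem_range] at hj
    exact habs _ (by omega) (by omega)
  obtain ⟨hlt, hcf⟩ := convergentMatrix_first_column _ hmem
  rw [special_form_iff_exists_convergentMatrix W k _ hlen, exists_eq_mul_A_zpow_iff, ← hcf,
    div_eq_div_iff (Int.cast_ne_zero.mpr hy)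
      (Int.cast_ne_zero.mpr (abs_pos.mp ((abs_nonneg _).trans_lt hlt)))]
  norm_cast
end

section
/- Let (b_1, …, b_k) be a simple continued fraction expansion (SCFE) whose value cf(b_1, …, b_k) is not equal to 1 or −1, and define the list b' = (−b_k, …, −b_2, −b_1, −1, b_1 − 1, b_2, …, b_k) of length 2k + 1. Then the evaluation of b' is well-defined (no division by zero occurs), |cf(b')| < 1, and cf(b') has the same sign as −b_k. -/
/-- The list b' = (−b_k, …, −b_2, −b_1, −1, b_1 − 1, b_2, …, b_k). -/
def bPrime (b : List ℤ) : List ℤ :=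
  (b.map fun x => -x).reverse ++ [-1] ++ [b.headD 0 - 1] ++ b.tail

theorem scfe_singleton {a : ℤ} (h : SCFE [a]) : 2 ≤ |a| := by
  simpa using h.2.2.2

theorem scfe_cons_cons {a c : ℤ} {l : List ℤ} (h : SCFE (a :: c :: l)) :
    a * c ≤ 0 ∧ c ≠ 0 ∧ SCFE (c :: l) := by
  obtain ⟨-, hmul, hne, hlast⟩ := h
  refine ⟨by simpa using hmul 0 (by simp), by simpa using hne 1 (by simp) (by simp), by simp,
    fun i hi => ?_, fun i hi hil => ?_, by simpa using hlast⟩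
  · simpa using hmul (i + 1) (by simpa using hi)
  · simpa using hne (i + 1) (by simp) (by simpa using hil)

theorem abs_one_div_lt_one {q : ℚ} (hq : 1 < |q|) : |1 / q| < 1 := by
  rw [abs_div, abs_one, div_lt_one (by linarith)]
  exact hq

/-- A simple continued fraction with nonzero first coefficient `c` is well-defined, and its value
lies in `(-1, 1)` and has the sign of `c`. -/
theorem cf_of_scfe {c : ℤ} {l : List ℤ} (h : SCFE (c :: l)) (hc : c ≠ 0) :
    cfWD (c :: l) ∧ |cf (c :: l)| < 1 ∧ 0 < cf (c :: l) * c := by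
  suffices H : cfWD l ∧ 1 < |(c : ℚ) - cf l| ∧ 0 < ((c : ℚ) - cf l) * c by
    obtain ⟨hwd, habs, hpos⟩ := H
    have hq : (c : ℚ) - cf l ≠ 0 := fun h0 => by simp [h0] at hpos
    refine ⟨⟨sub_ne_zero.mp hq, hwd⟩, abs_one_div_lt_one habs, ?_⟩
    have : cf (c :: l) * c = ((c : ℚ) - cf l) * c / ((c : ℚ) - cf l) ^ 2 := by
      simp only [cf]
      field_simp
    rw [this]
    positivity
  induction l generalizing c with
  | nil =>
    have h2 : (2 : ℚ) ≤ |(c : ℚ)| := by exact_mod_cast scfe_singleton h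
    have hc' : (c : ℚ) ≠ 0 := by exact_mod_cast hc
    refine ⟨trivial, by simp only [cf, sub_zero]; linarith, ?_⟩
    simp only [cf, sub_zero]
    exact mul_self_pos.mpr hc'
  | cons d l ih =>
    obtain ⟨hcd, hd, hl⟩ := scfe_cons_cons h
    obtain ⟨hwd, habs, hpos⟩ := ih hl hd
    have hq : (d : ℚ) - cf l ≠ 0 := fun h0 => by simp [h0] at hpos
    have hinv : 0 < (1 / ((d : ℚ) - cf l)) * d := by
      have : (1 / ((d : ℚ) - cf l)) * d = ((d : ℚ) - cf l) * d / ((d : ℚ) - cf l) ^ 2 := by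
        field_simp
      rw [this]
      positivity
    refine ⟨⟨sub_ne_zero.mp hq, hwd⟩, ?_⟩
    simp only [cf]
    generalize 1 / ((d : ℚ) - cf l) = t at hinv
    rcases lt_or_gt_of_ne hc with hc | hc
    · have hd' : (0 : ℚ) < d := by
        have : 0 < d := lt_of_le_of_ne (by nlinarith) (Ne.symm hd)
        exact_mod_cast this
      have ht : 0 < t := pos_of_mul_pos_left hinv hd'.le
      have hc' : (c : ℚ) ≤ -1 := by exact_mod_cast Int.le_sub_one_of_lt hc
      exact ⟨by rw [abs_of_neg] <;> linarith,
        mul_pos_of_neg_of_neg (by linarith) (by linarith)⟩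
    · have hd' : (d : ℚ) < 0 := by
        have : d < 0 := lt_of_le_of_ne (by nlinarith) hd
        exact_mod_cast this
      have ht : t < 0 := by nlinarith
      have hc' : (1 : ℚ) ≤ c := by exact_mod_cast hc
      exact ⟨by rw [abs_of_pos] <;> linarith, mul_pos (by linarith) (by linarith)⟩

/-- The list `r` has a well-defined evaluation in `(-1, 1)` whose sign is opposite to `c`. -/
def OppositeSmall (r : List ℤ) (c : ℤ) : Prop :=
  cfWD r ∧ |cf r| < 1 ∧ cf r * c < 0

theorem oppositeSmall_cons {b c : ℤ} {r : List ℤ} (hr : cfWD r)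
    (hpos : 0 < c → (b : ℚ) - cf r < -1) (hneg : c < 0 → 1 < (b : ℚ) - cf r) (hc : c ≠ 0) :
    OppositeSmall (b :: r) c := by
  rcases lt_or_gt_of_ne hc with hc | hc
  · have hq := hneg hc
    refine ⟨⟨fun h => by linarith, hr⟩, abs_one_div_lt_one (lt_abs.mpr (Or.inl hq)), ?_⟩
    exact mul_neg_of_pos_of_neg (one_div_pos.mpr (by linarith)) (by exact_mod_cast hc)
  · have hq := hpos hc
    refine ⟨⟨fun h => by linarith, hr⟩,
      abs_one_div_lt_one (lt_abs.mpr (Or.inr (by linarith))), ?_⟩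
    exact mul_neg_of_neg_of_pos (one_div_neg.mpr (by linarith)) (by exact_mod_cast hc)

theorem OppositeSmall.reverse_append {c : ℤ} {l r : List ℤ} (hr : OppositeSmall r c)
    (h : SCFE (c :: l)) (hc : c ≠ 0) :
    OppositeSmall ((l.map fun x => -x).reverse ++ r) ((c :: l).getLastD 0) := by
  induction l generalizing c r with
  | nil => simpa using hr
  | cons d l ih =>
    obtain ⟨hcd, hd, hl⟩ := scfe_cons_cons h
    obtain ⟨hwd, -, hsign⟩ := hr
    have key : OppositeSmall (-d :: r) d := by
      refine oppositeSmall_cons hwd (fun hd0 => ?_) (fun hd0 => ?_) hd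
      · have hc' : (c : ℚ) < 0 := by
          have : c < 0 := lt_of_le_of_ne (by nlinarith) hc
          exact_mod_cast this
        have hd' : (1 : ℚ) ≤ d := by exact_mod_cast hd0
        have : 0 < cf r := by nlinarith
        push_cast
        linarith
      · have hc' : (0 : ℚ) < c := by
          have : 0 < c := lt_of_le_of_ne (by nlinarith) (Ne.symm hc)
          exact_mod_cast this
        have hd' : (d : ℚ) ≤ -1 := by exact_mod_cast Int.le_sub_one_of_lt hd0
        have : cf r < 0 := by nlinarith
        push_cast
        linarith
    simpa using ih key hl hd

theorem cf_neg_one_cons_sub_one_cons {a : ℤ} {l : List ℤ} (hl : cfWD l)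
    (h0 : (a : ℚ) - cf l ≠ 0) (h1 : (a : ℚ) - cf l ≠ 1) :
    cfWD (-1 :: (a - 1) :: l) ∧ cf (-1 :: (a - 1) :: l) = 1 / ((a : ℚ) - cf l) - 1 := by
  have e : ((a - 1 : ℤ) : ℚ) - cf l = ((a : ℚ) - cf l) - 1 := by push_cast; ring
  have h1' : ((a : ℚ) - cf l) - 1 ≠ 0 := sub_ne_zero.mpr h1
  have e2 : ((-1 : ℤ) : ℚ) - 1 / (((a : ℚ) - cf l) - 1)
      = -((a : ℚ) - cf l) / (((a : ℚ) - cf l) - 1) := by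
    push_cast
    field_simp
    ring
  refine ⟨⟨?_, ?_, hl⟩, ?_⟩
  · rw [← sub_ne_zero]
    simp only [cf]
    rw [e, e2]
    exact div_ne_zero (neg_ne_zero.mpr h0) h1'
  · rw [← sub_ne_zero, e]
    exact h1'
  · simp only [cf]
    rw [e, e2]
    field_simp
    ring

/-- The end of `bPrime (a :: l)`, starting from the coefficient `-a`. -/
def bPrimeTail (a : ℤ) (l : List ℤ) : List ℤ :=
  -a :: -1 :: (a - 1) :: l

theorem bPrime_cons (a : ℤ) (l : List ℤ) :
    bPrime (a :: l) = (l.map fun x => -x).reverse ++ bPrimeTail a l := by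
  simp [bPrime, bPrimeTail]

theorem oppositeSmall_bPrimeTail {a : ℤ} {l : List ℤ} (h : SCFE (a :: l)) (ha : a ≠ 0)
    (ha1 : a ≠ 1) : OppositeSmall (bPrimeTail a l) a := by
  obtain ⟨⟨-, hwd⟩, habs, hpos⟩ := cf_of_scfe h ha
  simp only [cf] at habs hpos
  have hq0 : (a : ℚ) - cf l ≠ 0 := fun h0 => by simp [h0] at hpos
  have hq1 : (a : ℚ) - cf l ≠ 1 := fun h0 => by norm_num [h0] at habs
  obtain ⟨hwd', hval⟩ := cf_neg_one_cons_sub_one_cons hwd hq0 hq1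
  rw [abs_lt] at habs
  refine oppositeSmall_cons hwd' (fun ha0 => ?_) (fun ha0 => ?_) ha
  · have ha2 : (2 : ℚ) ≤ a := by exact_mod_cast (by omega : 2 ≤ a)
    have : 0 < 1 / ((a : ℚ) - cf l) := pos_of_mul_pos_left hpos (by linarith)
    rw [hval]
    push_cast
    linarith
  · have ha2 : (a : ℚ) ≤ -1 := by exact_mod_cast (by omega : a ≤ -1)
    have : 1 / ((a : ℚ) - cf l) < 0 := by nlinarith
    rw [hval]
    push_cast
    linarith

theorem oppositeSmall_bPrimeTail_one {c : ℤ} {l : List ℤ} (h : SCFE (1 :: c :: l)) :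
    OppositeSmall (-c :: bPrimeTail 1 (c :: l)) c := by
  obtain ⟨hmul, hc, hl⟩ := scfe_cons_cons h
  have hc0 : c < 0 := lt_of_le_of_ne (by linarith) hc
  have hc1 : (c : ℚ) ≤ -1 := by exact_mod_cast Int.le_sub_one_of_lt hc0
  obtain ⟨hwd, habs, hpos⟩ := cf_of_scfe hl hc
  generalize c :: l = m at *
  have ht : cf m < 0 := by nlinarith
  have hq0 : ((1 : ℤ) : ℚ) - cf m ≠ 0 := by push_cast; linarith
  have hq1 : ((1 : ℤ) : ℚ) - cf m ≠ 1 := by push_cast; linarith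
  obtain ⟨hwd', hval⟩ := cf_neg_one_cons_sub_one_cons hwd hq0 hq1
  have hden : ((-1 : ℤ) : ℚ) - cf (-1 :: (1 - 1) :: m) = -(1 / (1 - cf m)) := by
    rw [hval]
    push_cast
    ring
  have hcf : cf (bPrimeTail 1 m) = -(1 - cf m) := by
    rw [bPrimeTail, cf, hden]
    simp
  refine oppositeSmall_cons ⟨?_, hwd'⟩ (fun h => by omega) (fun _ => ?_) hc
  · rw [← sub_ne_zero, hden]
    exact neg_ne_zero.mpr (one_div_ne_zero (by linarith))
  · rw [hcf]
    push_cast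
    linarith

theorem oppositeSmall_bPrimeTail_zero {c : ℤ} {l : List ℤ} (h : SCFE (0 :: c :: l)) :
    OppositeSmall (-c :: bPrimeTail 0 (c :: l)) c := by
  obtain ⟨-, hc, hl⟩ := scfe_cons_cons h
  obtain ⟨hwd, habs, hpos⟩ := cf_of_scfe hl hc
  have ht0 : cf (c :: l) ≠ 0 := fun h0 => by simp [h0] at hpos
  rw [abs_lt] at habs
  have hq0 : ((0 : ℤ) : ℚ) - cf (c :: l) ≠ 0 := by simpa using ht0
  have hq1 : ((0 : ℤ) : ℚ) - cf (c :: l) ≠ 1 := fun h0 => by push_cast at h0; linarith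
  obtain ⟨hwd', hval⟩ := cf_neg_one_cons_sub_one_cons hwd hq0 hq1
  have hden : ((-0 : ℤ) : ℚ) - cf (-1 :: (0 - 1) :: c :: l)
      = (1 + cf (c :: l)) / cf (c :: l) := by
    rw [hval]
    push_cast
    field_simp
    ring
  have hcf : cf (bPrimeTail 0 (c :: l)) = cf (c :: l) / (1 + cf (c :: l)) := by
    rw [bPrimeTail, cf, hden, one_div_div]
  have hwd0 : cfWD (bPrimeTail 0 (c :: l)) := by
    refine ⟨?_, hwd'⟩
    rw [← sub_ne_zero, hden]
    exact div_ne_zero (by linarith) ht0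
  refine oppositeSmall_cons hwd0 (fun hc0 => ?_) (fun hc0 => ?_) hc
  · have hc1 : (1 : ℚ) ≤ c := by exact_mod_cast hc0
    have ht : 0 < cf (c :: l) := pos_of_mul_pos_left hpos (by linarith)
    rw [hcf]
    have : 0 < cf (c :: l) / (1 + cf (c :: l)) := by positivity
    push_cast
    linarith
  · have hc1 : (c : ℚ) ≤ -1 := by exact_mod_cast Int.le_sub_one_of_lt hc0
    have ht : cf (c :: l) < 0 := by nlinarith
    rw [hcf]
    have : cf (c :: l) / (1 + cf (c :: l)) < 0 := div_neg_of_neg_of_pos ht (by linarith)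
    push_cast
    linarith

theorem bPrime_oppositeSmall {b : List ℤ} (hb : SCFE b) :
    OppositeSmall (bPrime b) (b.getLastD 0) := by
  obtain _ | ⟨a, l⟩ := b
  · exact absurd rfl hb.1
  rw [bPrime_cons]
  by_cases ha : a = 0 ∨ a = 1
  · obtain _ | ⟨c, l⟩ := l
    · have := scfe_singleton hb
      rcases ha with rfl | rfl <;> norm_num at this
    obtain ⟨-, hc, hl⟩ := scfe_cons_cons hb
    have key : OppositeSmall (-c :: bPrimeTail a (c :: l)) c := by
      rcases ha with rfl | rfl
      · exact oppositeSmall_bPrimeTail_zero hb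
      · exact oppositeSmall_bPrimeTail_one hb
    simpa using key.reverse_append hl hc
  · push Not at ha
    exact (oppositeSmall_bPrimeTail hb ha.1 ha.2).reverse_append hb ha.1

/-- for a SCFE `(b_1, …, b_k)` with value `≠ ±1`, the list
`b' = (−b_k, …, −b_1, −1, b_1 − 1, b_2, …, b_k)` has a well-defined evaluation, `|cf(b')| < 1`,
and `cf(b')` has the same sign as `−b_k`. -/
theorem bPrime_size (b : List ℤ) (hb : SCFE b)
    (h1 : cf b ≠ 1) (h2 : cf b ≠ -1) :
    cfWD (bPrime b) ∧ |cf (bPrime b)| < 1 ∧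
      SignType.sign (cf (bPrime b)) = SignType.sign ((-(b.getLastD 0) : ℤ) : ℚ) := by
  obtain ⟨hwd, habs, hsign⟩ := bPrime_oppositeSmall hb
  refine ⟨hwd, habs, ?_⟩
  rw [Int.cast_neg]
  rcases mul_neg_iff.mp hsign with ⟨hx, hy⟩ | ⟨hx, hy⟩
  · rw [sign_pos hx, sign_pos (neg_pos.mpr hy)]
  · rw [sign_neg hx, sign_neg (neg_lt_zero.mpr hy)]
end

section
/- Let H ∈ SL(2, ℤ) be one of the three matrices A^{−1}B^{−1}, BA, or AB^{−1}, and let e(H) be the corresponding exponent sum, namely e(A^{−1}B^{−1}) = −2, e(BA) = 2, e(AB^{−1}) = 0. Then: (i) there are no integers n_1, n_2 with |n_1| ≤ 1, |n_2| ≥ 2, and n_1 + n_2 = e(H) such that B^{n_2} A^{n_1} is conjugate to H in SL(2, ℤ); and (ii) there are no integers n_1, n_2, n_3, n_4 with |n_1| ≤ 1, |n_2| ≥ 2, |n_3| ≥ 2, |n_4| ≥ 2, and n_1 + n_2 + n_3 + n_4 = e(H) such that B^{n_4} A^{n_3} B^{n_2} A^{n_1} is conjugate to H in SL(2, ℤ).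 -/
theorem coe_A_zpow (n : ℤ) : (↑(A ^ n) : Matrix (Fin 2) (Fin 2) ℤ) = !![1, -n; 0, 1] := by
  induction n with
  | zero => simp [Matrix.one_fin_two]
  | succ n ih =>
    rw [zpow_add_one, Matrix.SpecialLinearGroup.coe_mul, ih]
    simp [A]
  | pred n ih =>
    rw [zpow_sub_one, Matrix.SpecialLinearGroup.coe_mul, ih, Matrix.SpecialLinearGroup.coe_inv]
    simp [A, Matrix.adjugate_fin_two]

theorem coe_B_zpow (n : ℤ) : (↑(B ^ n) : Matrix (Fin 2) (Fin 2) ℤ) = !![1, 0; n, 1] := by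
  induction n with
  | zero => simp [Matrix.one_fin_two]
  | succ n ih =>
    rw [zpow_add_one, Matrix.SpecialLinearGroup.coe_mul, ih]
    simp [B]
  | pred n ih =>
    rw [zpow_sub_one, Matrix.SpecialLinearGroup.coe_mul, ih, Matrix.SpecialLinearGroup.coe_inv]
    simp [B, Matrix.adjugate_fin_two]
    ring

theorem trace_conj (H U : SL2Z) :
    (↑(U⁻¹ * H * U) : Matrix (Fin 2) (Fin 2) ℤ).trace =
      (↑H : Matrix (Fin 2) (Fin 2) ℤ).trace := by
  rw [Matrix.SpecialLinearGroup.coe_mul, Matrix.trace_mul_comm,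
    ← Matrix.SpecialLinearGroup.coe_mul, show U * (U⁻¹ * H) = H by group]

theorem trace_B_zpow_mul_A_zpow (a b : ℤ) :
    (↑(B ^ b * A ^ a) : Matrix (Fin 2) (Fin 2) ℤ).trace = 2 - a * b := by
  rw [Matrix.SpecialLinearGroup.coe_mul, coe_A_zpow, coe_B_zpow, Matrix.mul_fin_two,
    Matrix.trace_fin_two_of]
  ring

theorem trace_B_zpow_mul_A_zpow_mul_B_zpow_mul_A_zpow (a b c d : ℤ) :
    (↑(B ^ d * A ^ c * B ^ b * A ^ a) : Matrix (Fin 2) (Fin 2) ℤ).trace =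
      2 - (a + c) * (b + d) + a * b * c * d := by
  simp only [Matrix.SpecialLinearGroup.coe_mul, coe_A_zpow, coe_B_zpow, Matrix.mul_fin_two,
    Matrix.trace_fin_two_of]
  ring

theorem trace_and_exponent_sum {H : SL2Z} {e : ℤ}
    (hH : (H = A⁻¹ * B⁻¹ ∧ e = -2) ∨ (H = B * A ∧ e = 2) ∨ (H = A * B⁻¹ ∧ e = 0)) :
    ((↑H : Matrix (Fin 2) (Fin 2) ℤ).trace = 1 ∧ (e = -2 ∨ e = 2)) ∨
      ((↑H : Matrix (Fin 2) (Fin 2) ℤ).trace = 3 ∧ e = 0) := by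
  rcases hH with ⟨rfl, rfl⟩ | ⟨rfl, rfl⟩ | ⟨rfl, rfl⟩ <;>
    simp only [Matrix.SpecialLinearGroup.coe_mul, Matrix.SpecialLinearGroup.coe_inv] <;>
    simp [A, B, Matrix.adjugate_fin_two]

theorem mul_ne_of_isUnit {x y u : ℤ} (hx : 2 ≤ |x|) (hu : IsUnit u) : y * x ≠ u := by
  rintro rfl
  have h := Int.isUnit_iff.1 (isUnit_of_mul_isUnit_right hu)
  rcases h with rfl | rfl <;> norm_num at hx

theorem sub_one_mul_sub_one_ne_zero {x y : ℤ} (hx : 2 ≤ |x|) (hy : 2 ≤ |y|) :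
    (x - 1) * (y - 1) ≠ 0 := by
  intro h
  rcases mul_eq_zero.1 h with h | h
  · obtain rfl : x = 1 := by omega
    norm_num at hx
  · obtain rfl : y = 1 := by omega
    norm_num at hy

theorem sub_two_sq_ne_mul {b c d : ℤ} (hb : 2 ≤ |b|) (hc : 2 ≤ |c|) (hd : 2 ≤ |d|)
    (hsum : b + c + d = 3) : (c - 2) ^ 2 ≠ b * c * d := by
  intro h
  have hdvd : c ∣ 4 := ⟨b * d - c + 4, by linear_combination h⟩
  have hle := Int.le_of_dvd (by norm_num) hdvd
  have hge := Int.le_of_dvd (by norm_num) ((neg_dvd).2 hdvd)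
  have hlow : -4 ≤ c := by omega
  obtain rfl : d = 3 - c - b := by omega
  have hbb : b ≤ 10 := by
    by_contra! hlt
    interval_cases c <;> norm_num at hc <;> nlinarith
  have hbl : -10 ≤ b := by
    by_contra! hlt
    interval_cases c <;> norm_num at hc <;> nlinarith
  rw [le_abs] at hb hc hd
  interval_cases c <;> try omega
  all_goals interval_cases b <;> omega

/-- The trace equations for words of length four when the exponent sum is `2` and the
trace is `1`. -/
theorem four_exponents_trace_one {a b c d : ℤ} (ha : |a| ≤ 1) (hb : 2 ≤ |b|) (hc : 2 ≤ |c|)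
    (hd : 2 ≤ |d|) (hsum : a + b + c + d = 2) :
    2 - (a + c) * (b + d) + a * b * c * d ≠ 1 := by
  intro h
  have hc0 : c ≠ 0 := by rintro rfl; norm_num at hc
  obtain ⟨hl, hu⟩ := abs_le.1 ha
  interval_cases a
  · exact sub_two_sq_ne_mul hb hc hd (by omega) (by
      obtain rfl : d = 3 - b - c := by omega
      linear_combination h)
  · exact mul_ne_of_isUnit (y := b + d) (u := 1) hc isUnit_one (by linear_combination -h)
  · refine sub_one_mul_sub_one_ne_zero hb hd (mul_left_cancel₀ hc0 ?_)
    obtain rfl : c = 1 - b - d := by omega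
    linear_combination h

theorem four_exponents_trace_three {a b c d : ℤ} (ha : |a| ≤ 1) (hb : 2 ≤ |b|) (hc : 2 ≤ |c|)
    (hd : 2 ≤ |d|) (hsum : a + b + c + d = 0) :
    2 - (a + c) * (b + d) + a * b * c * d ≠ 3 := by
  intro h
  have hc0 : c ≠ 0 := by rintro rfl; norm_num at hc
  obtain ⟨hl, hu⟩ := abs_le.1 ha
  interval_cases a
  · rw [← abs_neg] at hb hd
    refine sub_one_mul_sub_one_ne_zero hb hd (mul_left_cancel₀ hc0 ?_)
    obtain rfl : c = 1 - b - d := by omega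
    linear_combination -h
  · exact mul_ne_of_isUnit (y := b + d) (u := -1) hc isUnit_one.neg (by linear_combination -h)
  · refine sub_one_mul_sub_one_ne_zero hb hd (mul_left_cancel₀ hc0 ?_)
    obtain rfl : c = -1 - b - d := by omega
    linear_combination h

/-- for `H ∈ {A⁻¹B⁻¹, BA, AB⁻¹}` with exponent sum `e(H) ∈ {−2, 2, 0}`
respectively, no word `B^{n_2} A^{n_1}` with `|n_1| ≤ 1`, `|n_2| ≥ 2` and `n_1 + n_2 = e(H)`
is conjugate to `H` in `SL(2,ℤ)`, and no word `B^{n_4} A^{n_3} B^{n_2} A^{n_1}` with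
`|n_1| ≤ 1`, `|n_i| ≥ 2` for `i = 2, 3, 4` and `n_1 + n_2 + n_3 + n_4 = e(H)` is conjugate
to `H` in `SL(2,ℤ)`. -/
theorem no_short_special_forms (H : SL2Z) (e : ℤ)
    (hH : (H = A⁻¹ * B⁻¹ ∧ e = -2) ∨ (H = B * A ∧ e = 2) ∨ (H = A * B⁻¹ ∧ e = 0)) :
    (¬ ∃ n1 n2 : ℤ, |n1| ≤ 1 ∧ 2 ≤ |n2| ∧ n1 + n2 = e ∧
      ∃ U : SL2Z, B ^ n2 * A ^ n1 = U⁻¹ * H * U) ∧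
    (¬ ∃ n1 n2 n3 n4 : ℤ, |n1| ≤ 1 ∧ 2 ≤ |n2| ∧ 2 ≤ |n3| ∧ 2 ≤ |n4| ∧
      n1 + n2 + n3 + n4 = e ∧
      ∃ U : SL2Z, B ^ n4 * A ^ n3 * B ^ n2 * A ^ n1 = U⁻¹ * H * U) := by
  have htr := trace_and_exponent_sum hH
  constructor
  · rintro ⟨a, b, -, hb, -, U, hU⟩
    have h := congrArg (fun X : SL2Z => (↑X : Matrix (Fin 2) (Fin 2) ℤ).trace) hU
    simp only [trace_conj, trace_B_zpow_mul_A_zpow] at h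
    rcases htr with ⟨ht, -⟩ | ⟨ht, -⟩
    · exact mul_ne_of_isUnit (y := a) (u := 1) hb isUnit_one (by linarith)
    · exact mul_ne_of_isUnit (y := a) (u := -1) hb isUnit_one.neg (by linarith)
  · rintro ⟨a, b, c, d, ha, hb, hc, hd, hsum, U, hU⟩
    have h := congrArg (fun X : SL2Z => (↑X : Matrix (Fin 2) (Fin 2) ℤ).trace) hU
    simp only [trace_conj, trace_B_zpow_mul_A_zpow_mul_B_zpow_mul_A_zpow] at h
    rcases htr with ⟨ht, rfl | rfl⟩ | ⟨ht, rfl⟩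
    · rw [← abs_neg] at ha hb hc hd
      exact four_exponents_trace_one ha hb hc hd (by linarith) (by linear_combination h + ht)
    · exact four_exponents_trace_one ha hb hc hd hsum (h.trans ht)
    · exact four_exponents_trace_three ha hb hc hd hsum (h.trans ht)
end
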